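/- Let f : ℕ → ℕ have controlled growth, fix k ≥ 1, let O = (v_n, n ≥ 1) be an activator sequence on G(f), and let D = (u_n, n ≥ 1) be the delayed activator sequence with u_1 = ⋯ = u_k = ∅ and u_{k+i} = v_i for all i ≥ 1. Then δ̲(G(f),D) = δ̲(G(f),O) and δ̄(G(f),D) = δ̄(G(f),O). -/

import Mathlib

open Filter Asymptotics

/-- Membership in the grid `[-f n, f n]^2 ⊆ ℤ × ℤ`. -/
def inGrid (f : ℕ → ℕ) (n : ℕ) (p : ℤ × ℤ) : Prop :=
  |p.1| ≤ (f n : ℤ) ∧ |p.2| ≤ (f n : ℤ)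

instance (f : ℕ → ℕ) (n : ℕ) : DecidablePred (inGrid f n) := fun _ => by
  unfold inGrid; infer_instance

/-- The four lattice neighbours (at `L¹`-distance one) of a point. -/
def nbrs (p : ℤ × ℤ) : Finset (ℤ × ℤ) :=
  {(p.1 + 1, p.2), (p.1 - 1, p.2), (p.1, p.2 + 1), (p.1, p.2 - 1)}

/-- An activator sequence: whenever `V n ≠ ∅` (for `n ≥ 1`), the activated vertex
lies in the grid at time `n`. -/
def IsActivator (f : ℕ → ℕ) (V : ℕ → Option (ℤ × ℤ)) : Prop :=
  ∀ n, 1 ≤ n → ∀ p, V n = some p → inGrid f n p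

/-- The burning process: `B 0 = ∅`, and `B n` is obtained from `B (n-1)` by adding all
vertices of the grid at time `n` adjacent to a vertex of `B (n-1)`, and then adding
the activator `V n` if it is not `∅`. -/
def burnSet (f : ℕ → ℕ) (V : ℕ → Option (ℤ × ℤ)) : ℕ → Finset (ℤ × ℤ)
  | 0 => ∅
  | n + 1 =>
    let B := burnSet f V n
    let spread := B ∪ (B.biUnion nbrs).filter (inGrid f (n + 1))
    match V (n + 1) with
    | none => spread
    | some v => insert v spread

/-- The proportion `|B n| / |V(G n)|` of burning vertices at time `n`. -/
noncomputable def densitySeq (f : ℕ → ℕ) (V : ℕ → Option (ℤ × ℤ)) (n : ℕ) : ℝ :=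
  ((burnSet f V n).card : ℝ) / (2 * (f n : ℝ) + 1) ^ 2

/-- The lower burning density `δ̲(G(f), V)`. -/
noncomputable def lowerDensity (f : ℕ → ℕ) (V : ℕ → Option (ℤ × ℤ)) : ℝ :=
  liminf (densitySeq f V) atTop

/-- The upper burning density `δ̄(G(f), V)`. -/
noncomputable def upperDensity (f : ℕ → ℕ) (V : ℕ → Option (ℤ × ℤ)) : ℝ :=
  limsup (densitySeq f V) atTop

/-- The burning density of `V` in `G(f)` exists and equals `ρ`. -/
def HasBurningDensity (f : ℕ → ℕ) (V : ℕ → Option (ℤ × ℤ)) (ρ : ℝ) : Prop :=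
  Tendsto (densitySeq f V) atTop (nhds ρ)

/-- `P(G(f))`: the set of `ρ ∈ [0,1]` achievable as the burning density of some
non-empty activator sequence. -/
def densSet (f : ℕ → ℕ) : Set ℝ :=
  {ρ | ρ ∈ Set.Icc (0 : ℝ) 1 ∧
    ∃ V : ℕ → Option (ℤ × ℤ), IsActivator f V ∧ (∃ t, 1 ≤ t ∧ V t ≠ none) ∧
      HasBurningDensity f V ρ}

/-- The controlled growth requirement. -/
def ControlledGrowth (f : ℕ → ℕ) : Prop :=
  (∀ᶠ n in atTop, f n < f (n + 1)) ∧
  (∀ ε : ℕ → ℕ, (fun n => (ε n : ℝ)) =o[atTop] (fun n => (n : ℝ)) →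
    Tendsto (fun n => (f (n + ε n) : ℝ) / (f n : ℝ)) atTop (nhds 1)) ∧
  (∀ c : ℝ, 0 < c → ∃ d : ℝ, 0 < d ∧
    ∀ᶠ n in atTop, (1 + d) * (f n : ℝ) ≤ (f (n + ⌈c * n⌉₊) : ℝ))

/-- The `L¹`-distance on `ℤ × ℤ`. -/
def l1Dist (p q : ℤ × ℤ) : ℕ := (p.1 - q.1).natAbs + (p.2 - q.2).natAbs

lemma mem_nbrs_iff_l1Dist_eq_one {p q : ℤ × ℤ} : q ∈ nbrs p ↔ l1Dist p q = 1 := by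
  obtain ⟨a, b⟩ := p
  obtain ⟨c, d⟩ := q
  simp only [nbrs, l1Dist, Finset.mem_insert, Finset.mem_singleton, Prod.mk.injEq]
  omega

lemma exists_l1Dist_lt {p x : ℤ × ℤ} (h : 0 < l1Dist p x) :
    ∃ y, l1Dist y x = 1 ∧ l1Dist p y + 1 = l1Dist p x := by
  obtain ⟨a, b⟩ := p
  obtain ⟨c, d⟩ := x
  simp only [l1Dist] at h ⊢
  rcases lt_trichotomy a c with h1 | h1 | h1
  · exact ⟨(c - 1, d), by dsimp only; omega, by dsimp only; omega⟩
  · rcases lt_trichotomy b d with h2 | h2 | h2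
    · exact ⟨(c, d - 1), by dsimp only; omega, by dsimp only; omega⟩
    · omega
    · exact ⟨(c, d + 1), by dsimp only; omega, by dsimp only; omega⟩
  · exact ⟨(c + 1, d), by dsimp only; omega, by dsimp only; omega⟩

lemma l1Dist_triangle (p q r : ℤ × ℤ) : l1Dist p r ≤ l1Dist p q + l1Dist q r := by
  simp only [l1Dist]
  omega

lemma l1Dist_self (p : ℤ × ℤ) : l1Dist p p = 0 := by simp [l1Dist]

/-- A point at distance at least `2 * M` from `p` can be moved `M` steps closer to `p`
along one of the four lattice directions. -/
lemma exists_direction_l1Dist {p x : ℤ × ℤ} {M : ℕ} (h : 2 * M ≤ l1Dist p x) :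
    ∃ d ∈ nbrs 0, ∀ j ∈ Finset.Icc 1 M,
      l1Dist p (x.1 - j * d.1, x.2 - j * d.2) + j = l1Dist p x := by
  obtain ⟨a, b⟩ := p
  obtain ⟨c, d⟩ := x
  simp only [l1Dist, Finset.mem_Icc] at h ⊢
  have key : (M : ℤ) ≤ c - a ∨ (M : ℤ) ≤ a - c ∨ (M : ℤ) ≤ d - b ∨ (M : ℤ) ≤ b - d := by omega
  rcases key with h1 | h1 | h1 | h1
  · exact ⟨(1, 0), by simp [nbrs], fun j hj => by dsimp only; omega⟩
  · exact ⟨(-1, 0), by simp [nbrs], fun j hj => by dsimp only; omega⟩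
  · exact ⟨(0, 1), by simp [nbrs], fun j hj => by dsimp only; omega⟩
  · exact ⟨(0, -1), by simp [nbrs], fun j hj => by dsimp only; omega⟩

section BurnSet

variable {f : ℕ → ℕ} {V : ℕ → Option (ℤ × ℤ)}

lemma inGrid_iff {n : ℕ} {p : ℤ × ℤ} :
    inGrid f n p ↔ p.1.natAbs ≤ f n ∧ p.2.natAbs ≤ f n := by
  unfold inGrid
  simp only [abs_le]
  omega

lemma mem_burnSet_succ {n : ℕ} {x : ℤ × ℤ} :
    x ∈ burnSet f V (n + 1) ↔ x ∈ burnSet f V n ∨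
      ((∃ y ∈ burnSet f V n, l1Dist y x = 1) ∧ inGrid f (n + 1) x) ∨ V (n + 1) = some x := by
  rw [burnSet]
  cases hV : V (n + 1) with
  | none => simp [mem_nbrs_iff_l1Dist_eq_one]
  | some v =>
    simp only [Finset.mem_insert, Finset.mem_union, Finset.mem_filter, Finset.mem_biUnion,
      mem_nbrs_iff_l1Dist_eq_one, Option.some.injEq, eq_comm (a := x)]
    rw [or_comm, or_assoc]

lemma burnSet_mono : Monotone (burnSet f V) :=
  monotone_nat_of_le_succ fun _ _ hx => mem_burnSet_succ.2 (Or.inl hx)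

lemma activator_mem_burnSet {n : ℕ} (hn : 1 ≤ n) {p : ℤ × ℤ} (h : V n = some p) :
    p ∈ burnSet f V n := by
  obtain ⟨m, rfl⟩ := Nat.exists_eq_add_of_le' hn
  exact mem_burnSet_succ.2 (Or.inr (Or.inr h))

lemma burnSet_nonempty_iff {n : ℕ} :
    (burnSet f V n).Nonempty ↔ ∃ s, 1 ≤ s ∧ s ≤ n ∧ V s ≠ none := by
  constructor
  · induction n with
    | zero => simp [burnSet]
    | succ n ih =>
      rintro ⟨x, hx⟩
      have lift : (burnSet f V n).Nonempty → ∃ s, 1 ≤ s ∧ s ≤ n + 1 ∧ V s ≠ none := by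
        intro h
        obtain ⟨s, h1, h2, h3⟩ := ih h
        exact ⟨s, h1, by omega, h3⟩
      rcases mem_burnSet_succ.1 hx with h | ⟨⟨y, hy, -⟩, -⟩ | h
      · exact lift ⟨x, h⟩
      · exact lift ⟨y, hy⟩
      · exact ⟨n + 1, by omega, le_rfl, by simp [h]⟩
  · rintro ⟨s, h1, h2, h3⟩
    obtain ⟨p, hp⟩ := Option.ne_none_iff_exists'.1 h3
    exact ⟨p, burnSet_mono h2 (activator_mem_burnSet h1 hp)⟩

/-- From time `N` on, the grid grows strictly and the burning vertices lie in the grid. -/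
def IsSettled (f : ℕ → ℕ) (V : ℕ → Option (ℤ × ℤ)) (N : ℕ) : Prop :=
  ∀ n, N ≤ n → f n < f (n + 1) ∧ ∀ p ∈ burnSet f V n, inGrid f n p

lemma IsSettled.mono {N N' : ℕ} (h : IsSettled f V N) (hN : N ≤ N') : IsSettled f V N' :=
  fun n hn => h n (hN.trans hn)

lemma tendsto_of_eventually_lt_succ (hf : ∀ᶠ n in atTop, f n < f (n + 1)) :
    Tendsto f atTop atTop := by
  obtain ⟨N, hN⟩ := eventually_atTop.1 hf
  rw [← tendsto_add_atTop_iff_nat N]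
  exact (strictMono_nat_of_lt_succ fun n => by
    simpa [add_right_comm] using hN (n + N) (by omega)).tendsto_atTop

lemma eventually_isSettled (hf : ∀ᶠ n in atTop, f n < f (n + 1)) (hV : IsActivator f V) :
    ∀ᶠ N in atTop, IsSettled f V N := by
  obtain ⟨N, hN⟩ := eventually_atTop.1 hf
  obtain ⟨R, hR⟩ : ∃ R, ∀ p ∈ burnSet f V N, p.1.natAbs ≤ R ∧ p.2.natAbs ≤ R := by
    refine ⟨(burnSet f V N).sup fun p => p.1.natAbs + p.2.natAbs, fun p hp => ?_⟩
    have := Finset.le_sup (f := fun p : ℤ × ℤ => p.1.natAbs + p.2.natAbs) hp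
    omega
  have bound : ∀ n, N ≤ n → ∀ p ∈ burnSet f V n,
      p.1.natAbs ≤ max R (f n) ∧ p.2.natAbs ≤ max R (f n) := by
    intro n hn
    induction n, hn using Nat.le_induction with
    | base => exact fun p hp => by have := hR p hp; omega
    | succ n hn ih =>
      intro p hp
      have hlt := hN n hn
      rcases mem_burnSet_succ.1 hp with h | ⟨-, h⟩ | h
      · have := ih p h
        omega
      · have := inGrid_iff.1 h
        omega
      · have := inGrid_iff.1 (hV _ (by omega) p h)
        omega
  filter_upwards [eventually_ge_atTop N,
    (eventually_forall_ge_atTop.2 ((tendsto_of_eventually_lt_succ hf).eventually_ge_atTop R))]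
    with m hm hR' n hn
  refine ⟨hN n (hm.trans hn), fun p hp => inGrid_iff.2 ?_⟩
  have := bound n (hm.trans hn) p hp
  have := hR' n hn
  omega

lemma IsSettled.mem_burnSet_of_l1Dist_le {N : ℕ} (h : IsSettled f V N) {s n : ℕ} (hs : N ≤ s)
    {p x : ℤ × ℤ} (hp : p ∈ burnSet f V s) (hx : s + l1Dist p x ≤ n) : x ∈ burnSet f V n := by
  refine burnSet_mono hx ?_
  clear hx
  generalize hr : l1Dist p x = r
  induction r generalizing x with
  | zero =>
    have : x = p := by
      simp only [l1Dist] at hr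
      ext <;> omega
    simpa [this] using hp
  | succ r ih =>
    obtain ⟨y, hyx, hpy⟩ := exists_l1Dist_lt (p := p) (x := x) (by omega)
    have hy : y ∈ burnSet f V (s + r) := ih (by omega)
    change x ∈ burnSet f V (s + r + 1)
    refine mem_burnSet_succ.2 (Or.inr (Or.inl ⟨⟨y, hy, hyx⟩, inGrid_iff.2 ?_⟩))
    obtain ⟨hlt, hgrid⟩ := h (s + r) (by omega)
    have := inGrid_iff.1 (hgrid y hy)
    simp only [l1Dist] at hyx
    omega

lemma exists_source_of_mem_burnSet {N n : ℕ} (hn : N ≤ n) {x : ℤ × ℤ}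
    (hx : x ∈ burnSet f V n) : ∃ s p, N ≤ s ∧ p ∈ burnSet f V s ∧ s + l1Dist p x ≤ n ∧
      (s = N ∨ V s = some p) := by
  induction n, hn using Nat.le_induction generalizing x with
  | base => exact ⟨N, x, le_rfl, hx, by simp [l1Dist_self], Or.inl rfl⟩
  | succ n hn ih =>
    rcases mem_burnSet_succ.1 hx with h | ⟨⟨y, hy, hyx⟩, -⟩ | h
    · obtain ⟨s, p, h1, h2, h3, h4⟩ := ih h
      exact ⟨s, p, h1, h2, by omega, h4⟩
    · obtain ⟨s, p, h1, h2, h3, h4⟩ := ih hy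
      have := l1Dist_triangle p y x
      exact ⟨s, p, h1, h2, by omega, h4⟩
    · exact ⟨n + 1, x, by omega, activator_mem_burnSet (by omega) h, by simp [l1Dist_self],
        Or.inr h⟩

/-- Two processes with the same activators after times `a` and `b`, respectively, contain
each other up to a bounded delay. -/
lemma exists_burnSet_subset_shift {W : ℕ → Option (ℤ × ℤ)} {a b : ℕ} (hV : IsSettled f V a)
    (hVW : ∀ i, 1 ≤ i → W (b + i) = V (a + i))
    (hne : (burnSet f W b).Nonempty → (burnSet f V a).Nonempty) :
    ∃ c, ∀ m, burnSet f W (b + m) ⊆ burnSet f V (a + m + c) := by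
  have base : ∃ c, ∀ p ∈ burnSet f W b, ∃ q ∈ burnSet f V a, l1Dist q p ≤ c := by
    rcases (burnSet f W b).eq_empty_or_nonempty with h | h
    · exact ⟨0, by simp [h]⟩
    · obtain ⟨q, hq⟩ := hne h
      exact ⟨(burnSet f W b).sup (l1Dist q), fun p hp => ⟨q, hq, Finset.le_sup hp⟩⟩
  obtain ⟨c, hc⟩ := base
  refine ⟨c, fun m x hx => ?_⟩
  obtain ⟨s, p, h1, h2, h3, h4⟩ := exists_source_of_mem_burnSet (Nat.le_add_right b m) hx
  rcases h1.eq_or_lt with rfl | hlt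
  · obtain ⟨q, hq, hqp⟩ := hc p h2
    have := l1Dist_triangle q p x
    exact hV.mem_burnSet_of_l1Dist_le le_rfl hq (by omega)
  · obtain ⟨i, rfl⟩ := Nat.exists_eq_add_of_lt hlt
    have hp : V (a + (i + 1)) = some p := by
      rw [← hVW (i + 1) (by omega)]
      exact h4.resolve_left (by omega)
    exact hV.mem_burnSet_of_l1Dist_le (Nat.le_add_right a (i + 1))
      (activator_mem_burnSet (by omega) hp) (by omega)

/-- Points outside `B` at the end of a run of `M` points of `B`, all in the same direction,
have disjoint runs. -/
lemma card_mul_le_of_runs {B T : Finset (ℤ × ℤ)} {M : ℕ} (d : ℤ × ℤ)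
    (hT : ∀ x ∈ T, x ∉ B ∧ ∀ j ∈ Finset.Icc 1 M, (x.1 - j * d.1, x.2 - j * d.2) ∈ B) :
    T.card * M ≤ B.card := by
  have hcard : (T ×ˢ Finset.Icc 1 M).card = T.card * M := by simp
  rw [← hcard]
  have aux : ∀ x ∈ T, ∀ y ∈ T, ∀ i ∈ Finset.Icc 1 M, ∀ j ∈ Finset.Icc 1 M,
      x.1 - i * d.1 = y.1 - j * d.1 → x.2 - i * d.2 = y.2 - j * d.2 → ¬ i < j := by
    intro x hx y hy i hi j hj h1 h2 hij
    rw [Finset.mem_Icc] at hi hj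
    refine (hT x hx).1 ?_
    convert (hT y hy).2 (j - i) (Finset.mem_Icc.2 ⟨by omega, by omega⟩) using 1
    ext
    · push_cast [hij.le]
      linarith
    · push_cast [hij.le]
      linarith
  refine Finset.card_le_card_of_injOn
    (fun z => (z.1.1 - z.2 * d.1, z.1.2 - z.2 * d.2)) ?_ ?_
  · rintro ⟨x, j⟩ hz
    obtain ⟨hx, hj⟩ := Finset.mem_product.1 hz
    exact (hT x hx).2 j hj
  · rintro ⟨x, i⟩ hz ⟨y, j⟩ hw heq
    obtain ⟨hx, hi⟩ := Finset.mem_product.1 hz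
    obtain ⟨hy, hj⟩ := Finset.mem_product.1 hw
    simp only [Prod.mk.injEq] at heq
    obtain ⟨h1, h2⟩ := heq
    have hij : i = j := le_antisymm
      (not_lt.1 (aux y hy x hx j hj i hi h1.symm h2.symm))
      (not_lt.1 (aux x hx y hy i hi j hj h1 h2))
    subst hij
    simp only [Prod.mk.injEq, and_true]
    ext <;> linarith

lemma IsSettled.card_burnSet_succ_le {N : ℕ} (h : IsSettled f V N) {M n : ℕ} (hM : 1 ≤ M)
    (hn : N + 2 * M ≤ n) :
    (burnSet f V (n + 1)).card ≤
      (burnSet f V n).card + (4 * ((burnSet f V n).card / M) + 2 * M * (4 * M + 1) ^ 2) := by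
  classical
  set B := burnSet f V n with hB
  let run : ℤ × ℤ → Finset (ℤ × ℤ) := fun d => (burnSet f V (n + 1) \ B).filter
    fun x => ∀ j ∈ Finset.Icc 1 M, (x.1 - j * d.1, x.2 - j * d.2) ∈ B
  let box : ℤ × ℤ → Finset (ℤ × ℤ) := fun p =>
    Finset.Icc (p.1 - 2 * M) (p.1 + 2 * M) ×ˢ Finset.Icc (p.2 - 2 * M) (p.2 + 2 * M)
  let near : ℕ → Finset (ℤ × ℤ) := fun i => (V (n + 1 - i)).elim ∅ box
  have hsub : burnSet f V (n + 1) ⊆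
      B ∪ ((nbrs 0).biUnion run ∪ (Finset.range (2 * M)).biUnion near) := by
    intro x hx
    by_cases hxB : x ∈ B
    · exact Finset.mem_union_left _ hxB
    refine Finset.mem_union_right _ ?_
    obtain ⟨s, p, h1, h2, h3, h4⟩ := exists_source_of_mem_burnSet (N := N) (by omega) hx
    by_cases hs : s + 2 * M ≤ n + 1
    · have hdist : ¬ s + l1Dist p x ≤ n := fun hle =>
        hxB (h.mem_burnSet_of_l1Dist_le h1 h2 hle)
      obtain ⟨d, hd, hrun⟩ := exists_direction_l1Dist (p := p) (x := x) (M := M) (by omega)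
      refine Finset.mem_union_left _ (Finset.mem_biUnion.2 ⟨d, hd, Finset.mem_filter.2
        ⟨Finset.mem_sdiff.2 ⟨hx, hxB⟩, fun j hj => h.mem_burnSet_of_l1Dist_le h1 h2 ?_⟩⟩)
      have := hrun j hj
      rw [Finset.mem_Icc] at hj
      omega
    · refine Finset.mem_union_right _ (Finset.mem_biUnion.2
        ⟨n + 1 - s, Finset.mem_range.2 (by omega), ?_⟩)
      have hVs : V (n + 1 - (n + 1 - s)) = some p := by
        rw [show n + 1 - (n + 1 - s) = s by omega]
        exact h4.resolve_left (by omega)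
      simp only [near, hVs, Option.elim, box, Finset.mem_product, Finset.mem_Icc]
      simp only [l1Dist] at h3
      omega
  have hrun : ((nbrs 0).biUnion run).card ≤ 4 * (B.card / M) := by
    refine (Finset.card_biUnion_le_card_mul _ _ (B.card / M) fun d _ => ?_).trans
      (Nat.mul_le_mul_right _ Finset.card_le_four)
    rw [Nat.le_div_iff_mul_le hM]
    refine card_mul_le_of_runs d fun x hx => ?_
    obtain ⟨hx1, hx2⟩ := Finset.mem_filter.1 hx
    exact ⟨(Finset.mem_sdiff.1 hx1).2, hx2⟩
  have hnear : ((Finset.range (2 * M)).biUnion near).card ≤ 2 * M * (4 * M + 1) ^ 2 := by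
    refine (Finset.card_biUnion_le_card_mul _ _ ((4 * M + 1) ^ 2) fun i _ => ?_).trans
      (by rw [Finset.card_range])
    cases hV : V (n + 1 - i) with
    | none => simp [near, hV]
    | some p =>
      simp only [near, hV, Option.elim, box, Finset.card_product, Int.card_Icc]
      rw [sq]
      exact Nat.mul_le_mul (by omega) (by omega)
  calc (burnSet f V (n + 1)).card ≤ _ := Finset.card_le_card hsub
    _ ≤ _ := Finset.card_union_le _ _
    _ ≤ _ := Nat.add_le_add_left ((Finset.card_union_le _ _).trans (add_le_add hrun hnear)) _

lemma IsSettled.card_burnSet_le {N n : ℕ} (h : IsSettled f V N) (hn : N ≤ n) :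
    (burnSet f V n).card ≤ (2 * f n + 1) ^ 2 := by
  have hsub : burnSet f V n ⊆
      Finset.Icc (-(f n : ℤ)) (f n) ×ˢ Finset.Icc (-(f n : ℤ)) (f n) := by
    intro p hp
    have := inGrid_iff.1 ((h n hn).2 p hp)
    simp only [Finset.mem_product, Finset.mem_Icc]
    omega
  refine (Finset.card_le_card hsub).trans ?_
  rw [Finset.card_product, Int.card_Icc, sq]
  exact Nat.mul_le_mul (by omega) (by omega)

end BurnSet

section Asymptotic

variable {f : ℕ → ℕ} {V : ℕ → Option (ℤ × ℤ)}

lemma tendsto_gridSize (hf : Tendsto f atTop atTop) :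
    Tendsto (fun n => (2 * (f n : ℝ) + 1) ^ 2) atTop atTop := by
  have h : Tendsto (fun n => (f n : ℝ)) atTop atTop := tendsto_natCast_atTop_atTop.comp hf
  refine tendsto_atTop_mono (fun n => ?_) h
  have : (0 : ℝ) ≤ f n := Nat.cast_nonneg _
  nlinarith

lemma ControlledGrowth.gridSize_succ_isBigO (hcg : ControlledGrowth f) :
    (fun n => (2 * (f (n + 1) : ℝ) + 1) ^ 2) =O[atTop] fun n => (2 * (f n : ℝ) + 1) ^ 2 := by
  have hlim : Tendsto (fun n => (f (n + 1) : ℝ) / (f n : ℝ)) atTop (nhds 1) :=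
    hcg.2.1 (fun _ => 1) (by
      simpa using (isLittleO_const_left.2 (Or.inr (tendsto_norm_atTop_atTop.comp
        (tendsto_natCast_atTop_atTop (R := ℝ)))) : (fun _ : ℕ => (1 : ℝ)) =o[atTop] _))
  refine IsBigO.pow ?_ 2
  refine IsBigO.of_bound 2 ?_
  filter_upwards [hlim.eventually_lt_const (show (1 : ℝ) < 3 / 2 by norm_num),
    (tendsto_of_eventually_lt_succ hcg.1).eventually_ge_atTop 1] with n h1 h2
  have hpos : (0 : ℝ) < f n := by exact_mod_cast h2
  have hnn : (0 : ℝ) ≤ f (n + 1) := Nat.cast_nonneg _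
  rw [div_lt_iff₀ hpos] at h1
  rw [Real.norm_of_nonneg (by positivity), Real.norm_of_nonneg (by positivity)]
  linarith

lemma card_burnSet_succ_sub_isLittleO (hf : ∀ᶠ n in atTop, f n < f (n + 1))
    (hV : IsActivator f V) :
    (fun n => ((burnSet f V (n + 1)).card : ℝ) - (burnSet f V n).card) =o[atTop]
      fun n => (2 * (f n : ℝ) + 1) ^ 2 := by
  obtain ⟨N, hN⟩ := (eventually_isSettled hf hV).exists
  refine IsLittleO.of_bound fun ε hε => ?_
  obtain ⟨M, hM⟩ := exists_nat_gt (8 / ε)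
  have hMpos : (0 : ℝ) < M := (by positivity : 0 < 8 / ε).trans hM
  have hM1 : 1 ≤ M := by exact_mod_cast hMpos
  set C : ℝ := 2 * M * (4 * M + 1) ^ 2
  filter_upwards [eventually_ge_atTop (N + 2 * M),
    (tendsto_gridSize (tendsto_of_eventually_lt_succ hf)).eventually_ge_atTop (2 * C / ε)]
    with n hn hC
  have hmono : ((burnSet f V n).card : ℝ) ≤ (burnSet f V (n + 1)).card := by
    exact_mod_cast Finset.card_le_card (burnSet_mono (Nat.le_succ n))
  have hle : ((burnSet f V (n + 1)).card : ℝ) ≤ (burnSet f V n).card +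
      (4 * ((burnSet f V n).card / M) + C) := by
    refine (Nat.cast_le.2 (hN.card_burnSet_succ_le hM1 hn)).trans ?_
    push_cast
    have := Nat.cast_div_le (α := ℝ) (m := (burnSet f V n).card) (n := M)
    linarith
  have hgrid : ((burnSet f V n).card : ℝ) ≤ (2 * (f n : ℝ) + 1) ^ 2 := by
    exact_mod_cast hN.card_burnSet_le (by omega)
  rw [Real.norm_of_nonneg (by linarith), Real.norm_of_nonneg (by positivity)]
  rw [div_le_iff₀ hε] at hC
  rw [div_lt_iff₀ hε] at hM
  have hdiv : ((burnSet f V n).card : ℝ) / M ≤ ε / 8 * (2 * (f n : ℝ) + 1) ^ 2 := by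
    rw [div_le_iff₀ hMpos]
    nlinarith [sq_nonneg (2 * (f n : ℝ) + 1)]
  linarith

lemma card_burnSet_add_sub_isLittleO (hcg : ControlledGrowth f) (hV : IsActivator f V) (c : ℕ) :
    (fun n => ((burnSet f V (n + c)).card : ℝ) - (burnSet f V n).card) =o[atTop]
      fun n => (2 * (f n : ℝ) + 1) ^ 2 := by
  induction c with
  | zero => simp
  | succ c ih =>
    have hstep := ((ih.comp_tendsto (tendsto_add_atTop_nat 1)).trans_isBigO
      hcg.gridSize_succ_isBigO).add (card_burnSet_succ_sub_isLittleO hcg.1 hV)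
    refine hstep.congr_left fun n => ?_
    simp only [Function.comp_apply, add_right_comm n 1 c, add_assoc n c 1]
    ring

lemma eventually_densitySeq_mem_Icc (hf : ∀ᶠ n in atTop, f n < f (n + 1))
    (hV : IsActivator f V) : ∀ᶠ n in atTop, densitySeq f V n ∈ Set.Icc (0 : ℝ) 1 := by
  filter_upwards [eventually_isSettled hf hV] with n hn
  refine ⟨by unfold densitySeq; positivity, div_le_one_of_le₀ ?_ (by positivity)⟩
  exact_mod_cast hn.card_burnSet_le le_rfl

end Asymptotic

lemma liminf_limsup_le_of_tendsto_sub {u v : ℕ → ℝ}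
    (hu : ∀ᶠ n in atTop, u n ∈ Set.Icc (0 : ℝ) 1) (hv : ∀ᶠ n in atTop, v n ∈ Set.Icc (0 : ℝ) 1)
    (h : Tendsto (fun n => u n - v n) atTop (nhds 0)) :
    liminf u atTop ≤ liminf v atTop ∧ limsup u atTop ≤ limsup v atTop := by
  have hu_le : atTop.IsBoundedUnder (· ≤ ·) u := ⟨1, eventually_map.2 (hu.mono fun n hn => hn.2)⟩
  have hu_ge : atTop.IsBoundedUnder (· ≥ ·) u := ⟨0, eventually_map.2 (hu.mono fun n hn => hn.1)⟩
  have hv_le : atTop.IsBoundedUnder (· ≤ ·) v := ⟨1, eventually_map.2 (hv.mono fun n hn => hn.2)⟩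
  have hv_ge : atTop.IsBoundedUnder (· ≥ ·) v := ⟨0, eventually_map.2 (hv.mono fun n hn => hn.1)⟩
  constructor
  · refine le_of_forall_pos_le_add fun ε hε => ?_
    rw [← sub_le_iff_le_add]
    refine le_of_forall_lt fun a ha => ?_
    obtain ⟨b, hab, hb⟩ := exists_between ha
    refine hab.trans_le (le_liminf_of_le hv_le.isCoboundedUnder_ge ?_)
    filter_upwards [eventually_lt_of_lt_liminf (lt_sub_iff_add_lt.1 hb) hu_ge,
      h.eventually_lt_const hε] with n h1 h2
    linarith
  · refine le_of_forall_pos_le_add fun ε hε => ?_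
    rw [← sub_le_iff_le_add]
    refine le_of_forall_gt fun a ha => ?_
    obtain ⟨b, hb, hba⟩ := exists_between ha
    have : limsup u atTop ≤ b + ε := by
      refine limsup_le_of_le hu_ge.isCoboundedUnder_le ?_
      filter_upwards [eventually_lt_of_limsup_lt hb hv_le, h.eventually_lt_const hε] with n h1 h2
      linarith
    linarith

/-- delaying an activator sequence by `k ≥ 1` rounds does not change
the lower and upper burning densities. -/
theorem delayed_sequence_same_density (f : ℕ → ℕ) (hcg : ControlledGrowth f)
    (k : ℕ) (hk : 1 ≤ k) (O D : ℕ → Option (ℤ × ℤ))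
    (hO : IsActivator f O) (hD : IsActivator f D)
    (hD1 : ∀ n, 1 ≤ n → n ≤ k → D n = none)
    (hD2 : ∀ i, 1 ≤ i → D (k + i) = O i) :
    lowerDensity f D = lowerDensity f O ∧ upperDensity f D = upperDensity f O := by
  obtain ⟨N, hN⟩ :=
    ((eventually_isSettled hcg.1 hO).and (eventually_isSettled hcg.1 hD)).exists
  obtain ⟨hNO, hND⟩ := hN
  have hshift : ∀ i, 1 ≤ i → D (k + N + i) = O (N + i) := fun i hi => by
    rw [add_assoc, hD2 _ (by omega)]
  have hDO : (burnSet f D (k + N)).Nonempty → (burnSet f O N).Nonempty := by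
    simp only [burnSet_nonempty_iff]
    rintro ⟨s, h1, h2, h3⟩
    have hs : k < s := by
      by_contra hle
      exact h3 (hD1 s h1 (by omega))
    obtain ⟨i, rfl⟩ := Nat.exists_eq_add_of_lt hs
    refine ⟨i + 1, by omega, by omega, ?_⟩
    rwa [← hD2 _ (by omega), ← add_assoc]
  have hOD : (burnSet f O N).Nonempty → (burnSet f D (k + N)).Nonempty := by
    simp only [burnSet_nonempty_iff]
    rintro ⟨s, h1, h2, h3⟩
    exact ⟨k + s, by omega, by omega, by rwa [hD2 s h1]⟩
  obtain ⟨c₁, hc₁⟩ := exists_burnSet_subset_shift hNO hshift hDO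
  obtain ⟨c₂, hc₂⟩ := exists_burnSet_subset_shift (hND.mono (Nat.le_add_left N k))
    (fun i hi => (hshift i hi).symm) hOD
  have hcard₁ : ∀ n, N ≤ n → (burnSet f D n).card ≤ (burnSet f O (n + c₁)).card := by
    intro n hn
    obtain ⟨m, rfl⟩ := Nat.exists_eq_add_of_le hn
    exact Finset.card_le_card ((burnSet_mono (by omega)).trans (hc₁ m))
  have hcard₂ : ∀ n, N ≤ n → (burnSet f O n).card ≤ (burnSet f D (n + (k + c₂))).card := by
    intro n hn
    obtain ⟨m, rfl⟩ := Nat.exists_eq_add_of_le hn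
    exact Finset.card_le_card ((hc₂ m).trans (burnSet_mono (by omega)))
  have hdiff : Tendsto (fun n => densitySeq f D n - densitySeq f O n) atTop (nhds 0) := by
    have t₁ := (card_burnSet_add_sub_isLittleO hcg hO c₁).tendsto_div_nhds_zero
    have t₂ := (card_burnSet_add_sub_isLittleO hcg hD (k + c₂)).tendsto_div_nhds_zero.neg
    rw [neg_zero] at t₂
    refine tendsto_of_tendsto_of_tendsto_of_le_of_le' t₂ t₁ ?_ ?_
    · filter_upwards [eventually_ge_atTop N] with n hn
      have : ((burnSet f O n).card : ℝ) ≤ (burnSet f D (n + (k + c₂))).card := by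
        exact_mod_cast hcard₂ n hn
      rw [densitySeq, densitySeq, ← sub_div, ← neg_div]
      gcongr
      linarith
    · filter_upwards [eventually_ge_atTop N] with n hn
      have : ((burnSet f D n).card : ℝ) ≤ (burnSet f O (n + c₁)).card := by
        exact_mod_cast hcard₁ n hn
      rw [densitySeq, densitySeq, ← sub_div]
      gcongr
  have hDmem := eventually_densitySeq_mem_Icc hcg.1 hD
  have hOmem := eventually_densitySeq_mem_Icc hcg.1 hO
  obtain ⟨hl, hu⟩ := liminf_limsup_le_of_tendsto_sub hDmem hOmem hdiff
  obtain ⟨hl', hu'⟩ := liminf_limsup_le_of_tendsto_sub hOmem hDmem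
    (by simpa using hdiff.neg)
  exact ⟨le_antisymm hl hl', le_antisymm hu hu'⟩
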